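/- arXiv:2511.11130 — 2 statements merged into one kernel-verified Lean document; each statement's English description precedes it below -/
import Mathlib

section
/- Let A = {y_1,…,y_k} ⊆ ℤ² be a set of k ≥ 2 distinct points. Then for every v ∈ {1,…,k} and every n ≥ 1, g_{y_v}^{0}(n | A∖{y_v}) = q_{y_v}^{0}(n) − Σ_{u=1, u≠v}^{k} Σ_{t=1}^{n} g_{y_u}^{0}(t | A∖{y_u}) · q_{y_v}^{y_u}(n-t), where the walks are started at the origin and at y_u respectively. -/
open Finset Classical

/-- The four unit steps of the simple random walk on `ℤ²`. -/
def D : Finset (ℤ × ℤ) := {(1,0), (-1,0), (0,1), (0,-1)}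

/-- Position after `t` steps of the walk started at `x0`, given a step sequence `ω`. -/
def pos {n : ℕ} (x0 : ℤ × ℤ) (ω : Fin n → D) (t : ℕ) : ℤ × ℤ :=
  x0 + ∑ i ∈ Finset.univ.filter (fun i : Fin n => (i : ℕ) < t), ((ω i : ℤ × ℤ))

/-- Probability of an event under the uniform measure on step sequences of length `n`. -/
noncomputable def prob (n : ℕ) (E : (Fin n → D) → Prop) : ℝ :=
  ((Finset.univ.filter E).card : ℝ) / 4 ^ n

/-- `p x n` : probability that the walk started at the origin is at `x` after `n` steps. -/
noncomputable def p (x : ℤ × ℤ) (n : ℕ) : ℝ :=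
  prob n (fun ω => pos 0 ω n = x)

/-- `qFrom x0 x n` : probability that the walk started at `x0` first arrives at `x` at step `n`. -/
noncomputable def qFrom (x0 x : ℤ × ℤ) (n : ℕ) : ℝ :=
  prob n (fun ω => pos x0 ω n = x ∧ ∀ t, 1 ≤ t → t < n → pos x0 ω t ≠ x)

/-- `g x0 y B n` : probability that the walk started at `x0` first reaches `y` at step `n`
without visiting any point of `B` during steps `1,…,n`. -/
noncomputable def g (x0 y : ℤ × ℤ) (B : Finset (ℤ × ℤ)) (n : ℕ) : ℝ :=
  prob n (fun ω => pos x0 ω n = y ∧ (∀ t, 1 ≤ t → t < n → pos x0 ω t ≠ y) ∧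
    (∀ t, 1 ≤ t → t ≤ n → pos x0 ω t ∉ B))

lemma pos_eq_ite {n : ℕ} (x0 : ℤ × ℤ) (ω : Fin n → D) (t : ℕ) :
    pos x0 ω t = x0 + ∑ i : Fin n, if (i : ℕ) < t then ((ω i : ℤ × ℤ)) else 0 := by
  unfold pos
  rw [Finset.sum_filter]

lemma pos_left {t m : ℕ} (x0 : ℤ × ℤ) (ω : Fin (t + m) → D) (s : ℕ) (hs : s ≤ t) :
    pos x0 (fun i : Fin t => ω (Fin.castAdd m i)) s = pos x0 ω s := by
  rw [pos_eq_ite, pos_eq_ite, Fin.sum_univ_add]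
  have : ∑ i : Fin m, (if ((Fin.natAdd t i : Fin (t + m)) : ℕ) < s
      then ((ω (Fin.natAdd t i) : ℤ × ℤ)) else 0) = 0 := by
    apply Finset.sum_eq_zero
    intro i _
    rw [if_neg]
    simp only [Fin.val_natAdd]
    omega
  rw [this, add_zero]
  simp only [Fin.val_castAdd]

lemma pos_right {t m : ℕ} (x0 : ℤ × ℤ) (ω : Fin (t + m) → D) (s : ℕ) :
    pos (pos x0 ω t) (fun i : Fin m => ω (Fin.natAdd t i)) s = pos x0 ω (t + s) := by
  rw [pos_eq_ite (pos x0 ω t), ← pos_left x0 ω t le_rfl, pos_eq_ite, pos_eq_ite,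
    Fin.sum_univ_add, add_assoc]
  congr 2
  · apply Finset.sum_congr rfl
    intro i _
    have := i.2
    rw [if_pos this, if_pos]
    simp only [Fin.val_castAdd]
    omega
  · apply Finset.sum_congr rfl
    intro i _
    simp only [Fin.val_natAdd, add_lt_add_iff_left]

lemma prob_mul (t m : ℕ) (E : (Fin t → D) → Prop) (F : (Fin m → D) → Prop) :
    prob t E * prob m F = prob (t + m) (fun ω => E (fun i => ω (Fin.castAdd m i)) ∧
      F (fun j => ω (Fin.natAdd t j))) := by
  unfold prob
  rw [div_mul_div_comm, ← pow_add, ← Nat.cast_mul, ← Finset.card_product]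
  congr 2
  refine Finset.card_bij' (fun a _ => Fin.append a.1 a.2)
    (fun ω _ => (fun i => ω (Fin.castAdd m i), fun j => ω (Fin.natAdd t j))) ?_ ?_ ?_ ?_
  · intro a ha
    simpa using ha
  · intro a ha
    simpa using ha
  · intro a ha
    simp
  · intro ω hω
    exact Fin.append_castAdd_natAdd

lemma prob_eq_sum (n : ℕ) (E : (Fin n → D) → Prop) :
    prob n E = (∑ ω : Fin n → D, if E ω then (1 : ℝ) else 0) / 4 ^ n := by
  unfold prob
  rw [Finset.sum_boole]

/-- Event: the walk hits `A` first at time `t`, at the point `a`, then reaches `b` at time `n`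
and not strictly between. -/
def Hit {n : ℕ} (A : Finset (ℤ × ℤ)) (a b : ℤ × ℤ) (t : ℕ) (ω : Fin n → D) : Prop :=
  pos 0 ω t = a ∧ (∀ s, 1 ≤ s → s < t → pos 0 ω s ∉ A) ∧ pos 0 ω n = b ∧
    ∀ s, t < s → s < n → pos 0 ω s ≠ b

lemma term_eq (A : Finset (ℤ × ℤ)) (a b : ℤ × ℤ) (ha : a ∈ A) (n t : ℕ) (htn : t ≤ n) :
    g 0 a (A.erase a) t * qFrom a b (n - t) = prob n (Hit A a b t) := by
  obtain ⟨m, rfl⟩ := Nat.exists_eq_add_of_le htn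
  rw [Nat.add_sub_cancel_left]
  unfold g qFrom
  rw [prob_mul]
  congr 1
  funext ω
  apply propext
  unfold Hit
  rw [pos_left 0 ω t le_rfl]
  constructor
  · rintro ⟨⟨h1, h2, h3⟩, h4, h5⟩
    subst h1
    rw [pos_right] at h4
    refine ⟨rfl, ?_, h4, ?_⟩
    · intro s hs hst hA
      have e2 := h2 s hs hst
      have e3 := h3 s hs hst.le
      rw [pos_left 0 ω s hst.le] at e2 e3
      exact e3 (Finset.mem_erase.2 ⟨e2, hA⟩)
    · intro s hs hsn
      have := h5 (s - t) (by omega) (by omega)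
      rw [pos_right, Nat.add_sub_cancel' hs.le] at this
      exact this
  · rintro ⟨h1, h2, h3, h4⟩
    subst h1
    refine ⟨⟨rfl, ?_, ?_⟩, ?_, ?_⟩
    · intro s hs hst
      rw [pos_left 0 ω s hst.le]
      intro h
      exact h2 s hs hst (h ▸ ha)
    · intro s hs hst
      rw [pos_left 0 ω s hst]
      rcases hst.lt_or_eq with h | h
      · exact fun h' => h2 s hs h (Finset.mem_of_mem_erase h')
      · subst h
        exact Finset.notMem_erase _ _
    · rw [pos_right]
      exact h3
    · intro s hs hsm
      rw [pos_right]
      exact h4 _ (by omega) (by omega)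

lemma pointwise (k : ℕ) (y : Fin k → ℤ × ℤ) (hy : Function.Injective y)
    (v : Fin k) (n : ℕ) (ω : Fin n → D) :
    (if pos 0 ω n = y v ∧ ∀ t, 1 ≤ t → t < n → pos 0 ω t ≠ y v then (1 : ℝ) else 0) =
    (if pos 0 ω n = y v ∧ (∀ t, 1 ≤ t → t < n → pos 0 ω t ≠ y v) ∧
      (∀ t, 1 ≤ t → t ≤ n → pos 0 ω t ∉ (Finset.image y Finset.univ).erase (y v))
      then (1 : ℝ) else 0) +
    ∑ u ∈ Finset.univ.filter (fun u : Fin k => u ≠ v), ∑ t ∈ Finset.Icc 1 n,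
      if Hit (Finset.image y Finset.univ) (y u) (y v) t ω then (1 : ℝ) else 0 := by
  have hmem : ∀ u, y u ∈ Finset.image y Finset.univ :=
    fun u => Finset.mem_image_of_mem y (Finset.mem_univ u)
  by_cases hq : pos 0 ω n = y v ∧ ∀ t, 1 ≤ t → t < n → pos 0 ω t ≠ y v
  · rw [if_pos hq]
    by_cases hg : ∀ t, 1 ≤ t → t ≤ n →
        pos 0 ω t ∉ (Finset.image y Finset.univ).erase (y v)
    · rw [if_pos ⟨hq.1, hq.2, hg⟩, Finset.sum_eq_zero, add_zero]
      intro u hu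
      apply Finset.sum_eq_zero
      intro t ht
      rw [Finset.mem_Icc] at ht
      rw [if_neg]
      intro h
      apply hg t ht.1 ht.2
      rw [h.1]
      exact Finset.mem_erase.2 ⟨fun e => (Finset.mem_filter.1 hu).2 (hy e), hmem u⟩
    · rw [if_neg (fun h => hg h.2.2), zero_add]
      have hex : ∃ t, 1 ≤ t ∧ t ≤ n ∧
          pos 0 ω t ∈ (Finset.image y Finset.univ).erase (y v) := by
        push Not at hg
        exact hg
      obtain ⟨h1, hn, hA⟩ := Nat.find_spec hex
      have hmin := fun s => @Nat.find_min _ _ hex s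
      generalize Nat.find hex = T at h1 hn hA hmin
      obtain ⟨hne, hA⟩ := Finset.mem_erase.1 hA
      obtain ⟨u, -, hu⟩ := Finset.mem_image.1 hA
      have hTn : T < n := by
        rcases hn.lt_or_eq with h | h
        · exact h
        · subst h
          exact absurd hq.1 hne
      have hfirst : ∀ s, 1 ≤ s → s < T → pos 0 ω s ∉ Finset.image y Finset.univ := by
        intro s hs hsT hsA
        exact hmin s hsT ⟨hs, by omega, Finset.mem_erase.2 ⟨hq.2 s hs (by omega), hsA⟩⟩
      have huv : u ≠ v := by
        rintro rfl
        exact hne hu.symm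
      rw [Finset.sum_eq_single u, Finset.sum_eq_single T, if_pos]
      · exact ⟨hu.symm, hfirst, hq.1, fun s hs hsn => hq.2 s (by omega) hsn⟩
      · intro t ht htT
        rw [Finset.mem_Icc] at ht
        rw [if_neg]
        intro h
        rcases lt_or_gt_of_ne htT with h' | h'
        · exact hfirst t ht.1 h' (h.1 ▸ hmem u)
        · exact h.2.1 T h1 h' hA
      · intro h
        exact absurd (Finset.mem_Icc.2 ⟨h1, hn⟩) h
      · intro u' _ hu'
        apply Finset.sum_eq_zero
        intro t ht
        rw [Finset.mem_Icc] at ht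
        rw [if_neg]
        intro h
        rcases lt_trichotomy t T with h' | h' | h'
        · exact hfirst t ht.1 h' (h.1 ▸ hmem u')
        · subst h'
          exact hu' (hy (h.1.symm.trans hu.symm))
        · exact h.2.1 T h1 h' hA
      · intro h
        exact absurd (Finset.mem_filter.2 ⟨Finset.mem_univ u, huv⟩) h
  · rw [if_neg hq, if_neg (fun h => hq ⟨h.1, h.2.1⟩), zero_add]
    symm
    apply Finset.sum_eq_zero
    intro u hu
    apply Finset.sum_eq_zero
    intro t ht
    rw [Finset.mem_Icc] at ht
    rw [if_neg]
    intro h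
    apply hq
    refine ⟨h.2.2.1, ?_⟩
    intro s hs hsn hsv
    rcases lt_trichotomy s t with h' | h' | h'
    · exact h.2.1 s hs h' (hsv ▸ hmem v)
    · subst h'
      exact (Finset.mem_filter.1 hu).2 (hy (h.1.symm.trans hsv))
    · exact h.2.2.2 s h' hsn hsv

theorem stmt7 (k : ℕ) (hk : 2 ≤ k) (y : Fin k → ℤ × ℤ) (hy : Function.Injective y)
    (v : Fin k) (n : ℕ) (hn : 1 ≤ n) :
    g 0 (y v) ((Finset.image y Finset.univ).erase (y v)) n =
      qFrom 0 (y v) n -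
        ∑ u ∈ Finset.univ.filter (fun u : Fin k => u ≠ v), ∑ t ∈ Finset.Icc 1 n,
          g 0 (y u) ((Finset.image y Finset.univ).erase (y u)) t *
            qFrom (y u) (y v) (n - t) := by
  have hterm : ∀ u ∈ Finset.univ.filter (fun u : Fin k => u ≠ v),
      ∑ t ∈ Finset.Icc 1 n, g 0 (y u) ((Finset.image y Finset.univ).erase (y u)) t *
            qFrom (y u) (y v) (n - t) =
      ∑ t ∈ Finset.Icc 1 n,
        (∑ ω : Fin n → D, if Hit (Finset.image y Finset.univ) (y u) (y v) t ω
          then (1 : ℝ) else 0) / 4 ^ n := by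
    intro u _
    apply Finset.sum_congr rfl
    intro t ht
    rw [term_eq _ _ _ (Finset.mem_image_of_mem y (Finset.mem_univ u)) n t
      (Finset.mem_Icc.1 ht).2, prob_eq_sum]
  rw [Finset.sum_congr rfl hterm, eq_sub_iff_add_eq]
  unfold g qFrom
  rw [prob_eq_sum, prob_eq_sum]
  simp only [← Finset.sum_div]
  rw [← add_div]
  congr 1
  have key := Finset.sum_congr (rfl : (Finset.univ : Finset (Fin n → D)) = Finset.univ)
    (fun ω _ => pointwise k y hy v n ω)
  rw [Finset.sum_add_distrib] at key
  have hcomm : (∑ ω : Fin n → D, ∑ u ∈ Finset.univ.filter (fun u : Fin k => u ≠ v),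
      ∑ t ∈ Finset.Icc 1 n,
        if Hit (Finset.image y Finset.univ) (y u) (y v) t ω then (1 : ℝ) else 0) =
      ∑ u ∈ Finset.univ.filter (fun u : Fin k => u ≠ v), ∑ t ∈ Finset.Icc 1 n,
        ∑ ω : Fin n → D,
          if Hit (Finset.image y Finset.univ) (y u) (y v) t ω then (1 : ℝ) else 0 := by
    rw [Finset.sum_comm]
    apply Finset.sum_congr rfl
    intro u _
    rw [Finset.sum_comm]
  rw [hcomm] at key
  symm
  convert key
end

section
/- Let A = {y_1,…,y_k} ⊆ ℤ² be a set of k ≥ 2 distinct points. Then for every v ∈ {1,…,k} and every n ≥ 1, d_{y_v}^{0}(n | A∖{y_v}) = q_{y_v}^{0}(n) − Σ_{u=1, u≠v}^{k} Σ_{t=1}^{n} g_{y_u}^{0}(t | A∖{y_u}) · [ q_{y_v}^{y_u}(n-t) − d_{y_v}^{y_u}(n-t | A∖{y_u, y_v}) ]. -/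
open Finset Classical

/-- `dW x0 y B n` : probability that the walk started at `x0` first reaches `y` at step `n`
without having visited all points of `B` by step `n` (so `dW x0 y ∅ n = 0`). -/
noncomputable def dW (x0 y : ℤ × ℤ) (B : Finset (ℤ × ℤ)) (n : ℕ) : ℝ :=
  prob n (fun ω => pos x0 ω n = y ∧ (∀ t, 1 ≤ t → t < n → pos x0 ω t ≠ y) ∧
    ¬ (∀ s ∈ B, ∃ t, 1 ≤ t ∧ t ≤ n ∧ pos x0 ω t = s))


lemma pos_append_left {t m : ℕ} (x0 : ℤ × ℤ) (a : Fin t → D) (b : Fin m → D) (s : ℕ) (hs : s ≤ t) :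
    pos x0 (Fin.append a b) s = pos x0 a s := by
  unfold pos
  rw [Finset.sum_filter, Finset.sum_filter, Fin.sum_univ_add]
  have : ∀ i : Fin m, ¬ (t + (i : ℕ) < s) := fun i => by omega
  simp [this]

lemma pos_append_right {t m : ℕ} (x0 : ℤ × ℤ) (a : Fin t → D) (b : Fin m → D) (s : ℕ) :
    pos x0 (Fin.append a b) (t + s) = pos (pos x0 a t) b s := by
  unfold pos
  rw [Finset.sum_filter, Finset.sum_filter, Finset.sum_filter, Fin.sum_univ_add]
  have : ∀ i : Fin t, ((i : ℕ) < t + s) := fun i => by omega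
  simp [this, add_assoc]

lemma prob_append {t m : ℕ} (E : (Fin t → D) → Prop) (F : (Fin m → D) → Prop)
    (H : (Fin (t + m) → D) → Prop) (h : ∀ a b, H (Fin.append a b) ↔ E a ∧ F b) :
    prob (t + m) H = prob t E * prob m F := by
  unfold prob
  have : (Finset.univ.filter H).card = (Finset.univ.filter E ×ˢ Finset.univ.filter F).card := by
    symm
    apply Finset.card_equiv (Fin.appendEquiv t m)
    rintro ⟨a, b⟩
    simp [Fin.appendEquiv, h]
  rw [this, Finset.card_product, pow_add]
  push_cast
  rw [div_mul_div_comm]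

/-- first arrival at `y` at step `n`, all points of `B` visited -/
def Cov (x0 y : ℤ × ℤ) (B : Finset (ℤ × ℤ)) (n : ℕ) (ω : Fin n → D) : Prop :=
  pos x0 ω n = y ∧ (∀ t, 1 ≤ t → t < n → pos x0 ω t ≠ y) ∧
    (∀ s ∈ B, ∃ t, 1 ≤ t ∧ t ≤ n ∧ pos x0 ω t = s)

lemma q_sub_d (x0 y : ℤ × ℤ) (B : Finset (ℤ × ℤ)) (n : ℕ) :
    qFrom x0 y n - dW x0 y B n = prob n (Cov x0 y B n) := by
  unfold qFrom dW prob
  rw [div_sub_div_same]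
  congr 1
  rw [sub_eq_iff_eq_add, ← Nat.cast_add]
  congr 1
  rw [← Finset.card_union_of_disjoint]
  · congr 1
    ext ω
    simp only [Finset.mem_filter, Finset.mem_union, Finset.mem_univ, true_and, Cov]
    tauto
  · rw [Finset.disjoint_left]
    intro ω
    simp only [Finset.mem_filter, Finset.mem_univ, true_and, Cov]
    tauto

/-- the piece of the event where the first visit to the set is at time `t` in `yu` -/
def Piece (yu yv : ℤ × ℤ) (B C : Finset (ℤ × ℤ)) (t n : ℕ) (ω : Fin n → D) : Prop :=
  (pos 0 ω t = yu ∧ (∀ s, 1 ≤ s → s < t → pos 0 ω s ≠ yu) ∧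
    (∀ s, 1 ≤ s → s ≤ t → pos 0 ω s ∉ B)) ∧
  (pos 0 ω n = yv ∧ (∀ s, 1 ≤ s → s < n - t → pos 0 ω (t + s) ≠ yv) ∧
    (∀ b ∈ C, ∃ s, 1 ≤ s ∧ s ≤ n - t ∧ pos 0 ω (t + s) = b))

lemma piece_prob (yu yv : ℤ × ℤ) (B C : Finset (ℤ × ℤ)) (t n : ℕ) (htn : t ≤ n) :
    g 0 yu B t * prob (n - t) (Cov yu yv C (n - t)) = prob n (Piece yu yv B C t n) := by
  obtain ⟨m, rfl⟩ := Nat.exists_eq_add_of_le htn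
  rw [Nat.add_sub_cancel_left]
  unfold g
  symm
  apply prob_append
  intro a b
  unfold Piece Cov
  simp only [pos_append_right, Nat.add_sub_cancel_left]
  rw [pos_append_left _ _ _ _ le_rfl]
  have h1 : (∀ s, 1 ≤ s → s < t → pos 0 (Fin.append a b) s ≠ yu) ↔
      (∀ s, 1 ≤ s → s < t → pos 0 a s ≠ yu) := by
    refine forall_congr' fun s => forall_congr' fun _ => forall_congr' fun hs => ?_
    rw [pos_append_left _ _ _ _ hs.le]
  have h2 : (∀ s, 1 ≤ s → s ≤ t → pos 0 (Fin.append a b) s ∉ B) ↔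
      (∀ s, 1 ≤ s → s ≤ t → pos 0 a s ∉ B) := by
    refine forall_congr' fun s => forall_congr' fun _ => forall_congr' fun hs => ?_
    rw [pos_append_left _ _ _ _ hs]
  rw [h1, h2]
  constructor
  · rintro ⟨⟨h, h'⟩, k⟩
    rw [h] at k
    exact ⟨⟨h, h'⟩, k⟩
  · rintro ⟨⟨h, h'⟩, k⟩
    rw [h]
    exact ⟨⟨rfl, h'⟩, k⟩

theorem stmt8 (k : ℕ) (hk : 2 ≤ k) (y : Fin k → ℤ × ℤ) (hy : Function.Injective y)
    (v : Fin k) (n : ℕ) (hn : 1 ≤ n) :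
    dW 0 (y v) ((Finset.image y Finset.univ).erase (y v)) n =
      qFrom 0 (y v) n -
        ∑ u ∈ Finset.univ.filter (fun u : Fin k => u ≠ v), ∑ t ∈ Finset.Icc 1 n,
          g 0 (y u) ((Finset.image y Finset.univ).erase (y u)) t *
            (qFrom (y u) (y v) (n - t) -
              dW (y u) (y v) (((Finset.image y Finset.univ).erase (y u)).erase (y v)) (n - t)) := by
  rw [eq_sub_iff_add_eq, ← eq_sub_iff_add_eq', q_sub_d]
  set A := Finset.image y Finset.univ with hA
  have hmem : ∀ u, y u ∈ A := fun u => by simp [hA]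
  have e : ∀ u ∈ Finset.univ.filter (fun u : Fin k => u ≠ v), ∀ t ∈ Finset.Icc 1 n,
      g 0 (y u) (A.erase (y u)) t * (qFrom (y u) (y v) (n - t) -
              dW (y u) (y v) ((A.erase (y u)).erase (y v)) (n - t)) =
      prob n (Piece (y u) (y v) (A.erase (y u)) ((A.erase (y u)).erase (y v)) t n) := by
    intro u _ t ht
    rw [q_sub_d, piece_prob _ _ _ _ _ _ (Finset.mem_Icc.1 ht).2]
  rw [Finset.sum_congr rfl fun u hu => Finset.sum_congr rfl (e u hu), ← Finset.sum_product']
  unfold prob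
  rw [← Finset.sum_div, ← Nat.cast_sum, ← Finset.card_biUnion]
  · congr 3
    ext ω
    simp only [Finset.mem_biUnion, Finset.mem_filter, Finset.mem_univ, true_and,
      Finset.mem_product, Finset.mem_Icc, Prod.exists]
    constructor
    · rintro ⟨u, t, ⟨huv, ht1, htn⟩, ⟨p1, p2, p3⟩, p4, p5, p6⟩
      have hyuv : y u ≠ y v := fun h => huv (hy h)
      refine ⟨p4, ?_, ?_⟩
      · intro s hs1 hsn hs
        rcases le_or_gt s t with h | h
        · exact p3 s hs1 h (by rw [hs]; exact Finset.mem_erase.2 ⟨hyuv.symm, hmem v⟩)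
        · refine p5 (s - t) (by omega) (by omega) ?_
          rwa [Nat.add_sub_cancel' h.le]
      · intro b hb
        by_cases hbu : b = y u
        · exact ⟨t, ht1, htn, by rw [p1, hbu]⟩
        · obtain ⟨s, h1, h2, h3⟩ := p6 b (by
            simp only [Finset.mem_erase] at hb ⊢
            exact ⟨hb.1, hbu, hb.2⟩)
          exact ⟨t + s, by omega, by omega, h3⟩
    · rintro ⟨c1, c2, c3⟩
      have hex : ∃ t, 1 ≤ t ∧ pos 0 ω t ∈ A := ⟨n, hn, by rw [c1]; exact hmem v⟩
      obtain ⟨w, hw⟩ : ∃ w : Fin k, w ≠ v := by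
        have : Nontrivial (Fin k) := Fin.nontrivial_iff_two_le.2 hk
        exact exists_ne v
      have hywv : y w ≠ y v := fun h => hw (hy h)
      obtain ⟨t0, a1, a2, a3⟩ := c3 (y w) (Finset.mem_erase.2 ⟨hywv, hmem w⟩)
      have ht0 : t0 < n := by
        rcases a2.lt_or_eq with h | h
        · exact h
        · subst h; exact absurd (a3.symm.trans c1) hywv
      have hle : Nat.find hex ≤ t0 := Nat.find_min' hex ⟨a1, by rw [a3]; exact hmem w⟩
      obtain ⟨b1, b2⟩ := Nat.find_spec hex
      have b3 : ∀ s, 1 ≤ s → s < Nat.find hex → pos 0 ω s ∉ A := fun s h1 h2 h3 =>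
        Nat.find_min hex h2 ⟨h1, h3⟩
      generalize Nat.find hex = t at *
      obtain ⟨u, -, hu⟩ := Finset.mem_image.1 b2
      have huv : u ≠ v := by
        rintro rfl
        exact c2 t b1 (by omega) hu.symm
      refine ⟨u, t, ⟨huv, b1, by omega⟩, ⟨hu.symm, ?_, ?_⟩, c1, ?_, ?_⟩
      · intro s h1 h2 h3
        exact b3 s h1 h2 (by rw [h3]; exact hmem u)
      · intro s h1 h2 h3
        rcases h2.lt_or_eq with h | h
        · exact b3 s h1 h (Finset.mem_erase.1 h3).2
        · subst h; exact (Finset.mem_erase.1 h3).1 hu.symm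
      · intro s h1 h2
        exact c2 _ (by omega) (by omega)
      · intro b hb
        simp only [Finset.mem_erase] at hb
        obtain ⟨s, h1, h2, h3⟩ := c3 b (Finset.mem_erase.2 ⟨hb.1, hb.2.2⟩)
        have hts : t < s := by
          by_contra hcon
          rcases (not_lt.1 hcon).lt_or_eq with h | h
          · exact b3 s h1 h (by rw [h3]; exact hb.2.2)
          · subst h; exact hb.2.1 (h3.symm.trans hu.symm)
        exact ⟨s - t, by omega, by omega, by rwa [Nat.add_sub_cancel' hts.le]⟩
  · rintro ⟨u, t⟩ h1 ⟨u', t'⟩ h2 hne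
    simp only [Finset.coe_product, Set.mem_prod, Finset.mem_coe, Finset.mem_Icc] at h1 h2
    rw [Function.onFun, Finset.disjoint_left]
    intro ω ho ho'
    apply hne
    obtain ⟨⟨p1, p2, p3⟩, -⟩ := (Finset.mem_filter.1 ho).2
    obtain ⟨⟨q1, q2, q3⟩, -⟩ := (Finset.mem_filter.1 ho').2
    have key : ∀ (u u' : Fin k) (t s : ℕ), 1 ≤ s → s < t → pos 0 ω s = y u' →
        (∀ s, 1 ≤ s → s < t → pos 0 ω s ≠ y u) →
        (∀ s, 1 ≤ s → s ≤ t → pos 0 ω s ∉ A.erase (y u)) → False := by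
      intro u u' t s h1 h2 h3 h4 h5
      exact h5 s h1 h2.le (Finset.mem_erase.2 ⟨h4 s h1 h2, by rw [h3]; exact hmem u'⟩)
    have htt : t = t' := by
      rcases lt_trichotomy t t' with h | h | h
      · exact (key u' u t' t h1.2.1 h p1 q2 q3).elim
      · exact h
      · exact (key u u' t t' h2.2.1 h q1 p2 p3).elim
    subst htt
    exact Prod.ext (hy (p1.symm.trans q1)) rfl
end
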